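/- arXiv:2405.00399 — 9 statements merged into one kernel-verified Lean document; each statement's English description precedes it below -/
import Mathlib

section
/- For every index j with 1 ≤ j ≤ N, the identity (λ̄_j − λ) b(p, ū_j) = λ b(u − p, ū_j) holds. (Abstract form of Lemma 2.2, the Strang-type identity relating the discrete eigenpairs to the projection of an exact eigenpair.) -/
open RealInnerProductSpace

/-- abstract form of Lemma 2.2, the Strang-type identity.
For every index `j`, `(λ̄_j − λ) b(p, ū_j) = λ b(u − p, ū_j)`. -/
theorem strang_identity
    {W : Type*} [NormedAddCommGroup W] [InnerProductSpace ℝ W]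
    (a : LinearMap.BilinForm ℝ W)
    (hsymm : ∀ x y : W, a x y = a y x)
    (hposdef : ∀ x : W, x ≠ 0 → 0 < a x x)
    (H : Submodule ℝ W) (N : ℕ) (hdim : Module.finrank ℝ H = N)
    (ubar : Fin N → W) (hmem : ∀ j, ubar j ∈ H)
    (lam : Fin N → ℝ) (hlampos : ∀ j, 0 < lam j) (hmono : Monotone lam)
    (horth : ∀ i j, a (ubar i) (ubar j) = if i = j then 1 else 0)
    (heig : ∀ j, ∀ v ∈ H, a (ubar j) v = lam j * ⟪ubar j, v⟫)
    (lam0 : ℝ) (hlam0 : 0 < lam0) (u : W)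
    (p : W) (hpH : p ∈ H)
    (hproj : ∀ v ∈ H, a p v = lam0 * ⟪u, v⟫) :
    ∀ j : Fin N, (lam j - lam0) * ⟪p, ubar j⟫ = lam0 * ⟪u - p, ubar j⟫ := by
  intro j
  have h : lam j * ⟪p, ubar j⟫ = lam0 * ⟪u, ubar j⟫ := by
    rw [real_inner_comm, ← heig j p hpH, hsymm, hproj _ (hmem j)]
  rw [inner_sub_left]
  linarith
end

section
/- Assume 1 ≤ k < N and δ > 0. Then ‖p − F_k p‖_a ≤ (√μ̄_{k+1} / δ) ‖u − p‖_b. (Key intermediate estimate in the proof of Theorem 2.3, obtained from the coefficient identity and Bessel's inequality for the b-orthonormal family ū_j/‖ū_j‖_b.) -/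
open RealInnerProductSpace

/-- The energy of a linear combination of a family orthonormal for a bilinear form is the sum of
the squared coefficients. -/
theorem bilinForm_self_sum_smul {ι W : Type*} [DecidableEq ι] [AddCommGroup W] [Module ℝ W]
    (a : LinearMap.BilinForm ℝ W) {e : ι → W}
    (horth : ∀ i j, a (e i) (e j) = if i = j then 1 else 0) (s : Finset ι) (c : ι → ℝ) :
    a (∑ i ∈ s, c i • e i) (∑ i ∈ s, c i • e i) = ∑ i ∈ s, c i ^ 2 := by
  simp only [map_sum, map_smul, LinearMap.sum_apply, LinearMap.smul_apply, smul_eq_mul, horth,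
    mul_ite, mul_one, mul_zero, Finset.sum_ite_eq']
  refine Finset.sum_congr rfl fun i hi => ?_
  simp [hi, sq]

/-- A family orthonormal for a bilinear form is linearly independent. -/
theorem linearIndependent_of_bilinForm_orthonormal {ι W : Type*} [DecidableEq ι]
    [AddCommGroup W] [Module ℝ W] (a : LinearMap.BilinForm ℝ W) {e : ι → W}
    (horth : ∀ i j, a (e i) (e j) = if i = j then 1 else 0) : LinearIndependent ℝ e := by
  rw [linearIndependent_iff']
  intro s g hg i hi
  have h : a (∑ j ∈ s, g j • e j) (e i) = 0 := by rw [hg]; simp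
  simpa [horth, hi] using h

/-- An orthonormal family (for a bilinear form) of `finrank` many vectors of a subspace expands
every vector of that subspace. -/
theorem eq_sum_bilinForm_smul {ι W : Type*} [Fintype ι] [DecidableEq ι] [AddCommGroup W]
    [Module ℝ W] (a : LinearMap.BilinForm ℝ W) (H : Submodule ℝ W) [FiniteDimensional ℝ H]
    (hdim : Module.finrank ℝ H = Fintype.card ι) {e : ι → W} (hmem : ∀ i, e i ∈ H)
    (horth : ∀ i j, a (e i) (e j) = if i = j then 1 else 0) {p : W} (hp : p ∈ H) :
    p = ∑ i, a p (e i) • e i := by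
  have hspan : Submodule.span ℝ (Set.range e) = H := by
    refine Submodule.eq_of_le_of_finrank_eq
      (Submodule.span_le.2 (Set.range_subset_iff.2 hmem)) ?_
    rw [finrank_span_eq_card (linearIndependent_of_bilinForm_orthonormal a horth), hdim]
  rw [← hspan, Submodule.mem_span_range_iff_exists_fun] at hp
  obtain ⟨c, rfl⟩ := hp
  simp [horth]

/-- Bessel's inequality for a family of orthogonal vectors `e i` with `‖e i‖² = (l i)⁻¹`. -/
theorem sum_mul_inner_sq_le {ι W : Type*} [DecidableEq ι] [NormedAddCommGroup W]
    [InnerProductSpace ℝ W] {e : ι → W} {l : ι → ℝ} (hl : ∀ i, 0 < l i)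
    (horth : ∀ i j, l i * ⟪e i, e j⟫ = if i = j then 1 else 0) (s : Finset ι) (w : W) :
    ∑ i ∈ s, l i * ⟪e i, w⟫ ^ 2 ≤ ‖w‖ ^ 2 := by
  have hon : Orthonormal ℝ fun i => √(l i) • e i := by
    rw [orthonormal_iff_ite]
    intro i j
    rw [real_inner_smul_left, real_inner_smul_right, ← horth i j]
    by_cases hij : i = j
    · subst hij
      rw [← mul_assoc, Real.mul_self_sqrt (hl i).le]
    · have h := horth i j
      rw [if_neg hij, mul_eq_zero] at h
      simp [h.resolve_left (hl i).ne']
  refine le_trans (le_of_eq (Finset.sum_congr rfl fun i _ => ?_))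
    (hon.sum_inner_products_le (s := s) w)
  rw [real_inner_smul_left, Real.norm_eq_abs, sq_abs, mul_pow, Real.sq_sqrt (hl i).le]

/-- With `F_k` the `a`-orthogonal projection onto
`span{ū_1,…,ū_k}` and `δ = min_{k<j≤N} |μ̄_j − μ| > 0`, one has
`‖p − F_k p‖_a ≤ (√μ̄_{k+1}/δ) ‖u − p‖_b`. -/
theorem projection_energy_estimate
    {W : Type*} [NormedAddCommGroup W] [InnerProductSpace ℝ W]
    (a : LinearMap.BilinForm ℝ W)
    (hsymm : ∀ x y : W, a x y = a y x)
    (hposdef : ∀ x : W, x ≠ 0 → 0 < a x x)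
    (H : Submodule ℝ W) (N : ℕ) (hdim : Module.finrank ℝ H = N)
    (ubar : Fin N → W) (hmem : ∀ j, ubar j ∈ H)
    (lam : Fin N → ℝ) (hlampos : ∀ j, 0 < lam j) (hmono : Monotone lam)
    (horth : ∀ i j, a (ubar i) (ubar j) = if i = j then 1 else 0)
    (heig : ∀ j, ∀ v ∈ H, a (ubar j) v = lam j * ⟪ubar j, v⟫)
    (lam0 : ℝ) (hlam0 : 0 < lam0) (u : W)
    (p : W) (hpH : p ∈ H)
    (hproj : ∀ v ∈ H, a p v = lam0 * ⟪u, v⟫)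
    (k : ℕ) (hk1 : 1 ≤ k) (hkN : k < N)
    (F : W → W)
    (hF : ∀ w, F w = ∑ j ∈ Finset.univ.filter (fun j : Fin N => (j : ℕ) < k),
      a w (ubar j) • ubar j)
    (δ : ℝ)
    (hδ : δ = sInf {r : ℝ | ∃ j : Fin N, k ≤ (j : ℕ) ∧ r = |(lam j)⁻¹ - lam0⁻¹|})
    (hδpos : 0 < δ) :
    Real.sqrt (a (p - F p) (p - F p)) ≤
      Real.sqrt ((lam ⟨k, hkN⟩)⁻¹) / δ * ‖u - p‖ := by
  have : FiniteDimensional ℝ H := Module.finite_of_finrank_pos (by omega)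
  have hexp := eq_sum_bilinForm_smul a H (by simpa using hdim) hmem horth hpH
  set s := Finset.univ.filter fun j : Fin N => ¬ (j : ℕ) < k with hs
  have hres : p - F p = ∑ j ∈ s, a p (ubar j) • ubar j := by
    rw [hF, sub_eq_iff_eq_add', Finset.sum_filter_add_sum_filter_not]
    exact hexp
  have hcoef : ∀ j, ⟪ubar j, u - p⟫ = (lam0⁻¹ - (lam j)⁻¹) * a p (ubar j) := by
    intro j
    have h₁ := hproj (ubar j) (hmem j)
    have h₂ := heig j p hpH
    rw [hsymm] at h₂
    have hj := (hlampos j).ne'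
    rw [inner_sub_right, real_inner_comm, sub_mul, inv_mul_eq_div, inv_mul_eq_div,
      eq_div_of_mul_eq hlam0.ne' ((mul_comm _ _).trans h₁.symm),
      eq_div_of_mul_eq hj ((mul_comm _ _).trans h₂.symm)]
  have hgap : ∀ j ∈ s, δ ≤ |(lam j)⁻¹ - lam0⁻¹| := by
    intro j hj
    rw [hδ]
    refine csInf_le ⟨0, ?_⟩ ⟨j, by simpa [hs] using hj, rfl⟩
    rintro r ⟨i, -, rfl⟩
    exact abs_nonneg _
  have hterm : ∀ j ∈ s, δ ^ 2 * a p (ubar j) ^ 2 ≤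
      (lam ⟨k, hkN⟩)⁻¹ * (lam j * ⟪ubar j, u - p⟫ ^ 2) := by
    intro j hj
    have hkj : lam ⟨k, hkN⟩ ≤ lam j := hmono (Fin.mk_le_of_le_val (by simpa [hs] using hj))
    calc δ ^ 2 * a p (ubar j) ^ 2
        ≤ |(lam j)⁻¹ - lam0⁻¹| ^ 2 * a p (ubar j) ^ 2 := by
          gcongr
          exact hgap j hj
      _ = 1 * ⟪ubar j, u - p⟫ ^ 2 := by
          rw [hcoef, sq_abs]
          ring
      _ ≤ ((lam ⟨k, hkN⟩)⁻¹ * lam j) * ⟪ubar j, u - p⟫ ^ 2 := by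
          gcongr
          rwa [inv_mul_eq_div, one_le_div (hlampos _)]
      _ = _ := mul_assoc _ _ _
  have hbessel := sum_mul_inner_sq_le hlampos
    (fun i j => (heig i (ubar j) (hmem j)).symm.trans (horth i j)) s (u - p)
  have hμ : 0 ≤ (lam ⟨k, hkN⟩)⁻¹ := (inv_pos.2 (hlampos _)).le
  rw [hres, bilinForm_self_sum_smul a horth]
  refine Real.sqrt_le_iff.2 ⟨by positivity, ?_⟩
  rw [mul_pow, div_pow, Real.sq_sqrt hμ, div_mul_eq_mul_div, le_div_iff₀' (by positivity),
    Finset.mul_sum]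
  refine (Finset.sum_le_sum hterm).trans ?_
  rw [← Finset.mul_sum]
  gcongr
end

section
/- Assume 1 ≤ k < N and δ > 0. Then ‖p − F_k p‖_b ≤ (μ̄_{k+1} / δ) ‖u − p‖_b. (Key intermediate b-norm estimate in the proof of Theorem 2.3.) -/
open RealInnerProductSpace

/-- A family in `H` orthonormal for a bilinear form `a` and of cardinality `finrank H` expands
every element of `H`, with coefficients given by `a`. -/
theorem eq_sum_smul_of_bilin_orthonormal {W : Type*} [AddCommGroup W] [Module ℝ W]
    (a : LinearMap.BilinForm ℝ W) (H : Submodule ℝ W) {N : ℕ} (hN : 0 < N)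
    (hdim : Module.finrank ℝ H = N) (e : Fin N → W) (hmem : ∀ j, e j ∈ H)
    (horth : ∀ i j, a (e i) (e j) = if i = j then 1 else 0) {p : W} (hp : p ∈ H) :
    p = ∑ j, a p (e j) • e j := by
  have : Nonempty (Fin N) := ⟨⟨0, hN⟩⟩
  have hcoeff (c : Fin N → ℝ) (i : Fin N) : a (∑ j, c j • e j) (e i) = c i := by
    simp [map_sum, LinearMap.sum_apply, horth]
  have hind : LinearIndependent ℝ fun j => (⟨e j, hmem j⟩ : H) := by
    refine LinearIndependent.of_comp H.subtype (Fintype.linearIndependent_iff.2 fun c hc i => ?_)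
    have hc : ∑ j, c j • e j = 0 := hc
    rw [← hcoeff c i, hc]
    simp
  have hspan := hind.span_eq_top_of_card_eq_finrank (by simp [hdim])
  have htop : (⟨p, hp⟩ : H) ∈ Submodule.span ℝ (Set.range fun j => (⟨e j, hmem j⟩ : H)) :=
    hspan ▸ Submodule.mem_top
  obtain ⟨c, hc⟩ := (Submodule.mem_span_range_iff_exists_fun ℝ).1 htop
  have hc : ∑ j, c j • e j = p := by simpa using congrArg (H.subtype) hc
  simp_rw [← hc, hcoeff]

/-- Inner product of two combinations of a family of mutually orthogonal vectors. -/
theorem inner_sum_smul_of_orthogonal {W ι : Type*} [NormedAddCommGroup W] [InnerProductSpace ℝ W]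
    [DecidableEq ι] (e : ι → W) (m : ι → ℝ)
    (horth : ∀ i j, ⟪e i, e j⟫ = if i = j then m i else 0) (s : Finset ι) (c d : ι → ℝ) :
    ⟪∑ i ∈ s, c i • e i, ∑ i ∈ s, d i • e i⟫ = ∑ i ∈ s, c i * d i * m i := by
  rw [sum_inner]
  refine Finset.sum_congr rfl fun i hi => ?_
  simp [inner_sum, inner_smul_left, inner_smul_right, horth, hi]
  ring

/-- key intermediate `b`-norm estimate in the proof of Theorem 2.3.
`‖p − F_k p‖_b ≤ (μ̄_{k+1}/δ) ‖u − p‖_b`. -/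
theorem projection_b_estimate
    {W : Type*} [NormedAddCommGroup W] [InnerProductSpace ℝ W]
    (a : LinearMap.BilinForm ℝ W)
    (hsymm : ∀ x y : W, a x y = a y x)
    (hposdef : ∀ x : W, x ≠ 0 → 0 < a x x)
    (H : Submodule ℝ W) (N : ℕ) (hdim : Module.finrank ℝ H = N)
    (ubar : Fin N → W) (hmem : ∀ j, ubar j ∈ H)
    (lam : Fin N → ℝ) (hlampos : ∀ j, 0 < lam j) (hmono : Monotone lam)
    (horth : ∀ i j, a (ubar i) (ubar j) = if i = j then 1 else 0)
    (heig : ∀ j, ∀ v ∈ H, a (ubar j) v = lam j * ⟪ubar j, v⟫)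
    (lam0 : ℝ) (hlam0 : 0 < lam0) (u : W)
    (p : W) (hpH : p ∈ H)
    (hproj : ∀ v ∈ H, a p v = lam0 * ⟪u, v⟫)
    (k : ℕ) (hk1 : 1 ≤ k) (hkN : k < N)
    (F : W → W)
    (hF : ∀ w, F w = ∑ j ∈ Finset.univ.filter (fun j : Fin N => (j : ℕ) < k),
      a w (ubar j) • ubar j)
    (δ : ℝ)
    (hδ : δ = sInf {r : ℝ | ∃ j : Fin N, k ≤ (j : ℕ) ∧ r = |(lam j)⁻¹ - lam0⁻¹|})
    (hδpos : 0 < δ) :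
    ‖p - F p‖ ≤ (lam ⟨k, hkN⟩)⁻¹ / δ * ‖u - p‖ := by
  have hinner (i j : Fin N) : ⟪ubar i, ubar j⟫ = if i = j then (lam i)⁻¹ else 0 := by
    have h := heig i (ubar j) (hmem j)
    rw [horth] at h
    have hi := (hlampos i).ne'
    split_ifs at h ⊢
    · exact eq_inv_of_mul_eq_one_right h.symm
    · exact (mul_eq_zero.1 h.symm).resolve_left hi
  have hδle (j : Fin N) (hj : k ≤ (j : ℕ)) : δ ≤ |(lam j)⁻¹ - lam0⁻¹| := by
    rw [hδ]
    refine csInf_le ⟨0, ?_⟩ ⟨j, hj, rfl⟩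
    rintro _ ⟨i, -, rfl⟩
    exact abs_nonneg _
  have hμle (j : Fin N) (hj : k ≤ (j : ℕ)) : (lam j)⁻¹ ≤ (lam ⟨k, hkN⟩)⁻¹ :=
    inv_anti₀ (hlampos _) (hmono hj)
  have hgap (j : Fin N) : (lam0⁻¹ - (lam j)⁻¹) * a p (ubar j) = ⟪u - p, ubar j⟫ := by
    have hu := hproj (ubar j) (hmem j)
    have hp : a p (ubar j) = lam j * ⟪p, ubar j⟫ := by
      rw [hsymm, heig j p hpH, real_inner_comm]
    have hj := (hlampos j).ne'
    rw [inner_sub_left, sub_mul]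
    congr 1
    · rw [hu]; field_simp
    · rw [hp]; field_simp
  set c : Fin N → ℝ := fun j => a p (ubar j)
  set s : Finset (Fin N) := Finset.univ.filter fun j => ¬ (j : ℕ) < k with hs
  set q : Fin N → ℝ := fun j => (lam j)⁻¹ / (lam0⁻¹ - (lam j)⁻¹) with hq
  set C : ℝ := (lam ⟨k, hkN⟩)⁻¹ / δ
  have hC0 : 0 ≤ C := div_nonneg (inv_nonneg.2 (hlampos _).le) hδpos.le
  have hr : p - F p = ∑ j ∈ s, c j • ubar j := by
    rw [hF, sub_eq_iff_eq_add', Finset.sum_filter_add_sum_filter_not]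
    exact eq_sum_smul_of_bilin_orthonormal a H (by omega) hdim ubar hmem horth hpH
  have hks (j : Fin N) (hj : j ∈ s) : k ≤ (j : ℕ) := by simpa [hs] using hj
  have hqC (j : Fin N) (hj : j ∈ s) : q j ^ 2 ≤ C ^ 2 := by
    rw [sq_le_sq, abs_of_nonneg hC0, hq, abs_div, abs_of_pos (inv_pos.2 (hlampos j)), abs_sub_comm]
    exact div_le_div₀ (inv_nonneg.2 (hlampos _).le) (hμle j (hks j hj)) hδpos (hδle j (hks j hj))
  have hnorm : ‖p - F p‖ ^ 2 = ∑ j ∈ s, c j * c j * (lam j)⁻¹ := by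
    rw [← real_inner_self_eq_norm_sq, hr, inner_sum_smul_of_orthogonal ubar _ hinner]
  set z : W := ∑ j ∈ s, (q j * c j) • ubar j with hz
  have hdual : ‖p - F p‖ ^ 2 = ⟪u - p, z⟫ := by
    rw [hnorm, hz, inner_sum]
    refine Finset.sum_congr rfl fun j hj => ?_
    have hne : lam0⁻¹ - (lam j)⁻¹ ≠ 0 := by
      rw [← abs_pos, abs_sub_comm]
      exact hδpos.trans_le (hδle j (hks j hj))
    have hqj : q j * (lam0⁻¹ - (lam j)⁻¹) = (lam j)⁻¹ := div_mul_cancel₀ _ hne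
    rw [inner_smul_right, ← hgap j]
    change c j * c j * (lam j)⁻¹ = q j * c j * ((lam0⁻¹ - (lam j)⁻¹) * c j)
    linear_combination -(c j * c j) * hqj
  have hzle : ‖z‖ ≤ C * ‖p - F p‖ := by
    refine le_of_sq_le_sq ?_ (by positivity)
    rw [mul_pow, hnorm, ← real_inner_self_eq_norm_sq, hz,
      inner_sum_smul_of_orthogonal ubar _ hinner, Finset.mul_sum]
    refine Finset.sum_le_sum fun j hj => ?_
    have h0 : 0 ≤ c j * c j * (lam j)⁻¹ :=
      mul_nonneg (mul_self_nonneg _) (inv_nonneg.2 (hlampos j).le)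
    calc q j * c j * (q j * c j) * (lam j)⁻¹ = q j ^ 2 * (c j * c j * (lam j)⁻¹) := by ring
      _ ≤ C ^ 2 * (c j * c j * (lam j)⁻¹) := mul_le_mul_of_nonneg_right (hqC j hj) h0
  rcases (norm_nonneg (p - F p)).eq_or_lt with h0 | h0
  · rw [← h0]
    positivity
  · refine le_of_mul_le_mul_right ?_ h0
    calc ‖p - F p‖ * ‖p - F p‖ = ⟪u - p, z⟫ := by rw [← sq, hdual]
      _ ≤ ‖u - p‖ * ‖z‖ := real_inner_le_norm _ _
      _ ≤ ‖u - p‖ * (C * ‖p - F p‖) := by gcongr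
      _ = C * ‖u - p‖ * ‖p - F p‖ := by ring
end

section
/- Assume 1 ≤ k < N, δ > 0, and that F_k is a contraction for the b-norm, i.e. ‖F_k w‖_b ≤ ‖w‖_b for all w ∈ W. Then ‖u − F_k u‖_b ≤ (2 + μ̄_{k+1}/δ) ‖u − p‖_b. (Abstract form of the L²-norm estimate (2.12) of Theorem 2.3.) -/
open RealInnerProductSpace

/-- A finite orthonormal family in a subspace whose dimension is the size of the family
reproduces every vector of the subspace. -/
theorem Orthonormal.sum_inner_smul_eq_of_finrank_eq
    {W : Type*} [NormedAddCommGroup W] [InnerProductSpace ℝ W] {ι : Type*} [Fintype ι]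
    {e : ι → W} (he : Orthonormal ℝ e) {H : Submodule ℝ W} [FiniteDimensional ℝ H]
    (hmem : ∀ j, e j ∈ H) (hdim : Module.finrank ℝ H = Fintype.card ι) {p : W} (hp : p ∈ H) :
    ∑ j, ⟪e j, p⟫ • e j = p := by
  have hspan : Submodule.span ℝ (Set.range e) = H := by
    refine Submodule.eq_of_le_of_finrank_eq (Submodule.span_le.2 ?_) ?_
    · rintro _ ⟨j, rfl⟩
      exact hmem j
    · rw [finrank_span_eq_card he.linearIndependent, hdim]
  rw [← hspan, Submodule.mem_span_range_iff_exists_fun] at hp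
  obtain ⟨c, rfl⟩ := hp
  simp only [he.inner_right_fintype]

/-- A partial orthonormal expansion of `p` is controlled by `w` when its coefficients are
controlled by those of `w`. -/
theorem Orthonormal.norm_sum_inner_smul_le
    {W : Type*} [NormedAddCommGroup W] [InnerProductSpace ℝ W] {ι : Type*}
    {e : ι → W} (he : Orthonormal ℝ e) (s : Finset ι) {p w : W} {C : ℝ} (hC : 0 ≤ C)
    (h : ∀ j ∈ s, |⟪e j, p⟫| ≤ C * |⟪e j, w⟫|) :
    ‖∑ j ∈ s, ⟪e j, p⟫ • e j‖ ≤ C * ‖w‖ := by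
  refine le_of_sq_le_sq ?_ (by positivity)
  calc ‖∑ j ∈ s, ⟪e j, p⟫ • e j‖ ^ 2 = ∑ j ∈ s, ⟪e j, p⟫ ^ 2 := by
        rw [← real_inner_self_eq_norm_sq, he.inner_sum]
        simp [pow_two]
    _ ≤ ∑ j ∈ s, C ^ 2 * ‖⟪e j, w⟫‖ ^ 2 := by
        refine Finset.sum_le_sum fun j hj => ?_
        rw [← sq_abs, Real.norm_eq_abs, ← mul_pow]
        exact pow_le_pow_left₀ (abs_nonneg _) (h j hj) 2
    _ ≤ (C * ‖w‖) ^ 2 := by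
        rw [← Finset.mul_sum, mul_pow]
        exact mul_le_mul_of_nonneg_left (he.sum_inner_products_le w) (sq_nonneg C)

/-- abstract form of the `L²`-norm estimate (2.12) of Theorem 2.3.
If moreover `F_k` is a `b`-norm contraction, then
`‖u − F_k u‖_b ≤ (2 + μ̄_{k+1}/δ) ‖u − p‖_b`. -/
theorem eigenfunction_b_estimate
    {W : Type*} [NormedAddCommGroup W] [InnerProductSpace ℝ W]
    (a : LinearMap.BilinForm ℝ W)
    (hsymm : ∀ x y : W, a x y = a y x)
    (hposdef : ∀ x : W, x ≠ 0 → 0 < a x x)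
    (H : Submodule ℝ W) (N : ℕ) (hdim : Module.finrank ℝ H = N)
    (ubar : Fin N → W) (hmem : ∀ j, ubar j ∈ H)
    (lam : Fin N → ℝ) (hlampos : ∀ j, 0 < lam j) (hmono : Monotone lam)
    (horth : ∀ i j, a (ubar i) (ubar j) = if i = j then 1 else 0)
    (heig : ∀ j, ∀ v ∈ H, a (ubar j) v = lam j * ⟪ubar j, v⟫)
    (lam0 : ℝ) (hlam0 : 0 < lam0) (u : W)
    (p : W) (hpH : p ∈ H)
    (hproj : ∀ v ∈ H, a p v = lam0 * ⟪u, v⟫)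
    (k : ℕ) (hk1 : 1 ≤ k) (hkN : k < N)
    (F : W → W)
    (hF : ∀ w, F w = ∑ j ∈ Finset.univ.filter (fun j : Fin N => (j : ℕ) < k),
      a w (ubar j) • ubar j)
    (δ : ℝ)
    (hδ : δ = sInf {r : ℝ | ∃ j : Fin N, k ≤ (j : ℕ) ∧ r = |(lam j)⁻¹ - lam0⁻¹|})
    (hδpos : 0 < δ)
    (hcontr : ∀ w : W, ‖F w‖ ≤ ‖w‖) :
    ‖u - F u‖ ≤ (2 + (lam ⟨k, hkN⟩)⁻¹ / δ) * ‖u - p‖ := by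
  have : FiniteDimensional ℝ H := Module.finite_of_finrank_pos (by omega)
  set e : Fin N → W := fun j => √(lam j) • ubar j with he_def
  have hemem : ∀ j, e j ∈ H := fun j => H.smul_mem _ (hmem j)
  have he : Orthonormal ℝ e := by
    rw [orthonormal_iff_ite]
    intro i j
    have hb : lam i * ⟪ubar i, ubar j⟫ = if i = j then 1 else 0 := by
      rw [← heig i _ (hmem j), horth]
    simp only [he_def, real_inner_smul_left, real_inner_smul_right]
    split_ifs at hb ⊢ with hij
    · subst hij
      rw [← mul_assoc, Real.mul_self_sqrt (hlampos i).le, hb]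
    · rw [(mul_eq_zero.1 hb).resolve_left (hlampos i).ne', mul_zero, mul_zero]
  have hFp : F p = ∑ j ∈ Finset.univ.filter (fun j : Fin N => (j : ℕ) < k), ⟪e j, p⟫ • e j := by
    rw [hF]
    refine Finset.sum_congr rfl fun j _ => ?_
    rw [hsymm, heig j p hpH]
    simp only [he_def, real_inner_smul_left, smul_smul]
    rw [mul_right_comm, Real.mul_self_sqrt (hlampos j).le]
  have hpF : p - F p =
      ∑ j ∈ Finset.univ.filter (fun j : Fin N => ¬ (j : ℕ) < k), ⟪e j, p⟫ • e j := by
    rw [sub_eq_iff_eq_add', hFp, Finset.sum_filter_add_sum_filter_not]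
    exact (he.sum_inner_smul_eq_of_finrank_eq hemem (by simpa using hdim) hpH).symm
  have hcoeff : ∀ j, ⟪e j, u - p⟫ = lam j * (lam0⁻¹ - (lam j)⁻¹) * ⟪e j, p⟫ := by
    intro j
    have h : lam0 * ⟪e j, u⟫ = lam j * ⟪e j, p⟫ := by
      rw [real_inner_comm, ← hproj _ (hemem j), hsymm]
      simp only [he_def, map_smul, LinearMap.smul_apply, smul_eq_mul, heig j p hpH,
        real_inner_smul_left]
      ring
    have hj := (hlampos j).ne'
    rw [inner_sub_right]
    field_simp
    linarith
  have hgap : ∀ j : Fin N, k ≤ (j : ℕ) → δ ≤ |(lam j)⁻¹ - lam0⁻¹| := by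
    intro j hj
    rw [hδ]
    refine csInf_le ⟨0, ?_⟩ ⟨j, hj, rfl⟩
    rintro _ ⟨i, -, rfl⟩
    exact abs_nonneg _
  have hlamk := hlampos ⟨k, hkN⟩
  have htail : ‖p - F p‖ ≤ (lam ⟨k, hkN⟩)⁻¹ / δ * ‖u - p‖ := by
    rw [hpF]
    refine he.norm_sum_inner_smul_le _ (by positivity) fun j hj => ?_
    have hkj : k ≤ (j : ℕ) := by simpa using hj
    have hlam : lam ⟨k, hkN⟩ ≤ lam j := hmono hkj
    rw [hcoeff, abs_mul, abs_mul, abs_of_pos (hlampos j), abs_sub_comm, ← mul_assoc]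
    refine le_mul_of_one_le_left (abs_nonneg _) ?_
    rw [div_mul_eq_mul_div, one_le_div hδpos, ← mul_assoc]
    refine (hgap j hkj).trans (le_mul_of_one_le_left (abs_nonneg _) ?_)
    rwa [inv_mul_eq_div, one_le_div hlamk]
  have hsub : F (u - p) = F u - F p := by
    simp only [hF, map_sub, LinearMap.sub_apply, sub_smul, Finset.sum_sub_distrib]
  calc ‖u - F u‖ = ‖(u - p) - F (u - p) + (p - F p)‖ := by rw [hsub]; congr 1; abel
    _ ≤ ‖u - p‖ + ‖F (u - p)‖ + ‖p - F p‖ :=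
        (norm_add_le _ _).trans (add_le_add_left (norm_sub_le _ _) _)
    _ ≤ ‖u - p‖ + ‖u - p‖ + (lam ⟨k, hkN⟩)⁻¹ / δ * ‖u - p‖ := by
        gcongr
        exact hcontr _
    _ = (2 + (lam ⟨k, hkN⟩)⁻¹ / δ) * ‖u - p‖ := by ring
end

section
/- Assume δ_λ > 0. Then ‖p − E_i p‖_a ≤ (√μ̄_1 / δ_λ) ‖u − p‖_b. (Key intermediate estimate in the proof of Theorem 2.6, the single-eigenpair case.) -/
open RealInnerProductSpace

/-- The quadratic value of `a` at a vector of a subspace with a full `b`-orthonormal system of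
eigenvectors is the eigenvalue-weighted sum of the squared coefficients. -/
lemma bilinForm_self_eq_sum_of_orthonormal_eigenvectors
    {W : Type*} [NormedAddCommGroup W] [InnerProductSpace ℝ W]
    (a : LinearMap.BilinForm ℝ W) (H : Submodule ℝ W) {ι : Type*} [Fintype ι]
    [FiniteDimensional ℝ H] (hdim : Module.finrank ℝ H = Fintype.card ι)
    (e : ι → W) (hmem : ∀ j, e j ∈ H) (he : Orthonormal ℝ e) (lam : ι → ℝ)
    (heig : ∀ j, ∀ v ∈ H, a (e j) v = lam j * ⟪e j, v⟫) (q : W) (hq : q ∈ H) :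
    a q q = ∑ j, lam j * ⟪e j, q⟫ ^ 2 := by
  have hv : Orthonormal ℝ (fun j => (⟨e j, hmem j⟩ : H)) := by
    classical
    rw [orthonormal_iff_ite] at he ⊢
    exact he
  have hspan := hv.linearIndependent.span_eq_top_of_card_eq_finrank' hdim.symm
  have hsum := congrArg (Subtype.val) ((OrthonormalBasis.mk hv hspan.ge).sum_repr' ⟨q, hq⟩)
  simp only [OrthonormalBasis.coe_mk, Submodule.coe_inner, Submodule.coe_sum,
    Submodule.coe_smul] at hsum
  calc a q q = a (∑ j, ⟪e j, q⟫ • e j) q := by rw [hsum]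
    _ = ∑ j, lam j * ⟪e j, q⟫ ^ 2 := by
      simp only [map_sum, map_smul, LinearMap.sum_apply, LinearMap.smul_apply, smul_eq_mul]
      refine Finset.sum_congr rfl fun j _ => ?_
      rw [heig j q hq]
      ring

/-- Eigenvectors of `a` with respect to `b` that are `a`-orthonormal become `b`-orthonormal after
scaling by the square roots of the eigenvalues. -/
lemma orthonormal_sqrt_smul_of_eigenvectors
    {W : Type*} [NormedAddCommGroup W] [InnerProductSpace ℝ W]
    (a : LinearMap.BilinForm ℝ W) {ι : Type*} [DecidableEq ι] (ubar : ι → W)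
    (lam : ι → ℝ) (hlampos : ∀ j, 0 < lam j)
    (horth : ∀ i j, a (ubar i) (ubar j) = if i = j then 1 else 0)
    (heig : ∀ i j, a (ubar i) (ubar j) = lam i * ⟪ubar i, ubar j⟫) :
    Orthonormal ℝ (fun j => √(lam j) • ubar j) := by
  rw [orthonormal_iff_ite]
  intro j k
  have h := (heig j k).symm.trans (horth j k)
  rw [real_inner_smul_left, real_inner_smul_right]
  split_ifs at h ⊢ with hjk
  · subst hjk
    rw [← mul_assoc, Real.mul_self_sqrt (hlampos j).le, h]
  · rw [(mul_eq_zero.mp h).resolve_left (hlampos j).ne']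
    simp

/-- key intermediate estimate in the proof of Theorem 2.6.
With `E_i` the `a`-orthogonal projection onto `span{ū_i}` and
`δ_λ = min_{j≠i} |μ̄_j − μ| > 0`, one has `‖p − E_i p‖_a ≤ (√μ̄_1/δ_λ) ‖u − p‖_b`. -/
theorem single_projection_energy_estimate
    {W : Type*} [NormedAddCommGroup W] [InnerProductSpace ℝ W]
    (a : LinearMap.BilinForm ℝ W)
    (hsymm : ∀ x y : W, a x y = a y x)
    (hposdef : ∀ x : W, x ≠ 0 → 0 < a x x)
    (H : Submodule ℝ W) (N : ℕ) (hdim : Module.finrank ℝ H = N)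
    (ubar : Fin N → W) (hmem : ∀ j, ubar j ∈ H)
    (lam : Fin N → ℝ) (hlampos : ∀ j, 0 < lam j) (hmono : Monotone lam)
    (horth : ∀ i j, a (ubar i) (ubar j) = if i = j then 1 else 0)
    (heig : ∀ j, ∀ v ∈ H, a (ubar j) v = lam j * ⟪ubar j, v⟫)
    (lam0 : ℝ) (hlam0 : 0 < lam0) (u : W)
    (p : W) (hpH : p ∈ H)
    (hproj : ∀ v ∈ H, a p v = lam0 * ⟪u, v⟫)
    (i : Fin N) (E : W → W)
    (hE : ∀ w, E w = a w (ubar i) • ubar i)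
    (δl : ℝ)
    (hδl : δl = sInf {r : ℝ | ∃ j : Fin N, j ≠ i ∧ r = |(lam j)⁻¹ - lam0⁻¹|})
    (hδlpos : 0 < δl) :
    Real.sqrt (a (p - E p) (p - E p)) ≤
      Real.sqrt ((lam ⟨0, i.pos⟩)⁻¹) / δl * ‖u - p‖ := by
  have : FiniteDimensional ℝ H := Module.finite_of_finrank_pos (hdim ▸ i.pos)
  have he := orthonormal_sqrt_smul_of_eigenvectors a ubar lam hlampos horth
    (fun j k => heig j _ (hmem k))
  set e : Fin N → W := fun j => √(lam j) • ubar j with he_def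
  have hemem : ∀ j, e j ∈ H := fun j => H.smul_mem _ (hmem j)
  have heeig : ∀ j, ∀ v ∈ H, a (e j) v = lam j * ⟪e j, v⟫ := by
    intro j v hv
    simp only [he_def, map_smul, LinearMap.smul_apply, smul_eq_mul, real_inner_smul_left,
      heig j v hv]
    ring
  have hqH : p - E p ∈ H := by
    rw [hE]
    exact H.sub_mem hpH (H.smul_mem _ (hmem i))
  have hgap : ∀ j, j ≠ i → δl ≤ |(lam j)⁻¹ - lam0⁻¹| := by
    intro j hj
    rw [hδl]
    refine csInf_le ⟨0, ?_⟩ ⟨j, hj, rfl⟩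
    rintro r ⟨k, -, rfl⟩
    exact abs_nonneg _
  have hcoeff : ∀ j, ⟪e j, p - E p⟫ = if j = i then 0 else ⟪e j, p⟫ := by
    intro j
    have h := heeig j _ hqH
    have h' := heeig j p hpH
    rw [map_sub, hE, map_smul, hsymm p] at h
    simp only [he_def, map_smul, LinearMap.smul_apply, smul_eq_mul, horth] at h h' ⊢
    rw [hE, hsymm p]
    apply mul_left_cancel₀ (hlampos j).ne'
    rw [← h]
    split_ifs with hj
    · subst hj
      ring
    · rw [← h']
      ring
  have hterm : ∀ j, lam j * ⟪e j, p - E p⟫ ^ 2 ≤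
      (lam ⟨0, i.pos⟩)⁻¹ / δl ^ 2 * ⟪e j, u - p⟫ ^ 2 := by
    intro j
    have hμ : 0 < (lam ⟨0, i.pos⟩)⁻¹ := inv_pos.mpr (hlampos _)
    rw [hcoeff]
    split_ifs with hj
    · simp only [ne_eq, OfNat.ofNat_ne_zero, not_false_eq_true, zero_pow, mul_zero]
      positivity
    have hlj := hlampos j
    have hu : lam j * ⟪e j, p⟫ = lam0 * ⟪e j, u⟫ := by
      rw [← heeig j p hpH, hsymm, hproj _ (hemem j), real_inner_comm]
    have hres : ⟪e j, u - p⟫ = -(lam j * ((lam j)⁻¹ - lam0⁻¹) * ⟪e j, p⟫) := by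
      rw [inner_sub_right]
      field_simp
      linarith
    have hδsq : δl ^ 2 ≤ ((lam j)⁻¹ - lam0⁻¹) ^ 2 := by
      rw [← sq_abs ((lam j)⁻¹ - lam0⁻¹)]
      exact pow_le_pow_left₀ hδlpos.le (hgap j hj) 2
    have hμj : (lam j)⁻¹ ≤ (lam ⟨0, i.pos⟩)⁻¹ :=
      inv_anti₀ (hlampos _) (hmono (Fin.mk_le_of_le_val (Nat.zero_le _)))
    calc lam j * ⟪e j, p⟫ ^ 2
        = (lam j)⁻¹ / δl ^ 2 * (lam j ^ 2 * δl ^ 2 * ⟪e j, p⟫ ^ 2) := by field_simp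
      _ ≤ (lam ⟨0, i.pos⟩)⁻¹ / δl ^ 2 *
          (lam j ^ 2 * ((lam j)⁻¹ - lam0⁻¹) ^ 2 * ⟪e j, p⟫ ^ 2) := by gcongr
      _ = (lam ⟨0, i.pos⟩)⁻¹ / δl ^ 2 * ⟪e j, u - p⟫ ^ 2 := by rw [hres]; ring
  have hbessel : ∑ j, ⟪e j, u - p⟫ ^ 2 ≤ ‖u - p‖ ^ 2 := by
    simpa using he.sum_inner_products_le (u - p) (s := Finset.univ)
  have hμ : 0 < (lam ⟨0, i.pos⟩)⁻¹ := inv_pos.mpr (hlampos _)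
  refine Real.sqrt_le_iff.mpr ⟨by positivity, ?_⟩
  rw [bilinForm_self_eq_sum_of_orthonormal_eigenvectors a H (by simpa using hdim) e hemem he lam
    heeig _ hqH, mul_pow, div_pow, Real.sq_sqrt hμ.le]
  calc ∑ j, lam j * ⟪e j, p - E p⟫ ^ 2
      ≤ ∑ j, (lam ⟨0, i.pos⟩)⁻¹ / δl ^ 2 * ⟪e j, u - p⟫ ^ 2 :=
        Finset.sum_le_sum fun j _ => hterm j
    _ ≤ (lam ⟨0, i.pos⟩)⁻¹ / δl ^ 2 * ‖u - p‖ ^ 2 := by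
      rw [← Finset.mul_sum]
      gcongr
end

section
/- Assume δ_λ > 0. Then ‖u − E_i u‖_a ≤ 2 ‖u − p‖_a + (√μ̄_1 / δ_λ) ‖u − p‖_b. (Abstract form of the energy-norm estimate (2.26) of Theorem 2.6 for a single eigenpair.) -/
open RealInnerProductSpace

/-- Triangle inequality for the seminorm of a symmetric positive semidefinite bilinear form. -/
theorem sqrt_bilinForm_add_le {W : Type*} [AddCommGroup W] [Module ℝ W]
    (a : LinearMap.BilinForm ℝ W) (hsymm : ∀ x y, a x y = a y x) (hnonneg : ∀ x, 0 ≤ a x x)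
    (x y : W) :
    Real.sqrt (a (x + y) (x + y)) ≤ Real.sqrt (a x x) + Real.sqrt (a y y) := by
  have hcs : a x y * a y x ≤ a x x * a y y :=
    LinearMap.BilinForm.apply_mul_apply_le_of_forall_zero_le a hnonneg x y
  have hxy : a x y ≤ Real.sqrt (a x x) * Real.sqrt (a y y) := by
    rw [← Real.sqrt_mul (hnonneg x)]
    refine Real.le_sqrt_of_sq_le ?_
    rwa [hsymm y x, ← sq] at hcs
  refine Real.sqrt_le_iff.mpr ⟨by positivity, ?_⟩
  have hexp : a (x + y) (x + y) = a x x + 2 * a x y + a y y := by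
    simp only [map_add, LinearMap.add_apply, hsymm y x]
    ring
  rw [hexp, add_sq, Real.sq_sqrt (hnonneg x), Real.sq_sqrt (hnonneg y)]
  linarith

/-- An orthonormal family whose cardinality is the dimension expands every vector. -/
theorem eq_sum_smul_of_bilinForm_orthonormal {W ι : Type*} [AddCommGroup W] [Module ℝ W]
    [Fintype ι] [DecidableEq ι] [Nonempty ι] (a : LinearMap.BilinForm ℝ W) (H : Submodule ℝ W)
    (hdim : Fintype.card ι = Module.finrank ℝ H) (e : ι → W) (hmem : ∀ j, e j ∈ H)
    (horth : ∀ i j, a (e i) (e j) = if i = j then 1 else 0) {p : W} (hp : p ∈ H) :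
    p = ∑ j, a p (e j) • e j := by
  have hcoord : ∀ (g : ι → ℝ) (k : ι), a (∑ j, g j • e j) (e k) = g k := by
    intro g k
    simp [map_sum, LinearMap.sum_apply, horth]
  have hli : LinearIndependent ℝ (fun j => (⟨e j, hmem j⟩ : H)) := by
    rw [Fintype.linearIndependent_iff]
    intro g hg k
    have hg' : ∑ j, g j • e j = 0 := by simpa using congrArg (Submodule.subtype H) hg
    rw [← hcoord g k, hg', map_zero, LinearMap.zero_apply]
  obtain ⟨d, hd⟩ : ∃ d : ι → ℝ, ∑ j, d j • e j = p := by
    have hspan := hli.span_eq_top_of_card_eq_finrank hdim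
    have hpt : (⟨p, hp⟩ : H) ∈ Submodule.span ℝ (Set.range fun j => (⟨e j, hmem j⟩ : H)) :=
      hspan ▸ Submodule.mem_top
    obtain ⟨d, hd⟩ := (Submodule.mem_span_range_iff_exists_fun ℝ).mp hpt
    exact ⟨d, by simpa using congrArg (Submodule.subtype H) hd⟩
  subst hd
  simp only [hcoord]

/-- abstract form of the energy-norm estimate (2.26) of Theorem 2.6.
`‖u − E_i u‖_a ≤ 2‖u − p‖_a + (√μ̄_1/δ_λ) ‖u − p‖_b`. -/
theorem single_eigenfunction_energy_estimate
    {W : Type*} [NormedAddCommGroup W] [InnerProductSpace ℝ W]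
    (a : LinearMap.BilinForm ℝ W)
    (hsymm : ∀ x y : W, a x y = a y x)
    (hposdef : ∀ x : W, x ≠ 0 → 0 < a x x)
    (H : Submodule ℝ W) (N : ℕ) (hdim : Module.finrank ℝ H = N)
    (ubar : Fin N → W) (hmem : ∀ j, ubar j ∈ H)
    (lam : Fin N → ℝ) (hlampos : ∀ j, 0 < lam j) (hmono : Monotone lam)
    (horth : ∀ i j, a (ubar i) (ubar j) = if i = j then 1 else 0)
    (heig : ∀ j, ∀ v ∈ H, a (ubar j) v = lam j * ⟪ubar j, v⟫)
    (lam0 : ℝ) (hlam0 : 0 < lam0) (u : W)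
    (p : W) (hpH : p ∈ H)
    (hproj : ∀ v ∈ H, a p v = lam0 * ⟪u, v⟫)
    (i : Fin N) (E : W → W)
    (hE : ∀ w, E w = a w (ubar i) • ubar i)
    (δl : ℝ)
    (hδl : δl = sInf {r : ℝ | ∃ j : Fin N, j ≠ i ∧ r = |(lam j)⁻¹ - lam0⁻¹|})
    (hδlpos : 0 < δl) :
    Real.sqrt (a (u - E u) (u - E u)) ≤
      2 * Real.sqrt (a (u - p) (u - p)) +
        Real.sqrt ((lam ⟨0, i.pos⟩)⁻¹) / δl * ‖u - p‖ := by
  have hnonneg : ∀ x, 0 ≤ a x x := fun x => by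
    rcases eq_or_ne x 0 with rfl | hx
    · simp
    · exact (hposdef x hx).le
  have hEnorm : ∀ w, a (w - E w) (w - E w) = a w w - a w (ubar i) ^ 2 := by
    intro w
    simp only [hE, map_sub, map_smul, LinearMap.sub_apply, LinearMap.smul_apply, smul_eq_mul,
      hsymm (ubar i) w, horth, if_true]
    ring
  have hcontr : Real.sqrt (a (u - p - E (u - p)) (u - p - E (u - p))) ≤
      Real.sqrt (a (u - p) (u - p)) := by
    rw [hEnorm]
    exact Real.sqrt_le_sqrt (by linarith [sq_nonneg (a (u - p) (ubar i))])
  have hinner : ∀ j, ⟪ubar j, u - p⟫ = (lam0⁻¹ - (lam j)⁻¹) * a p (ubar j) := by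
    intro j
    have hu : a p (ubar j) = lam0 * ⟪ubar j, u⟫ := by
      rw [hproj _ (hmem j), real_inner_comm]
    have hp : a p (ubar j) = lam j * ⟪ubar j, p⟫ := by rw [hsymm, heig j p hpH]
    rw [inner_sub_right, sub_mul]
    nth_rewrite 1 [hu]
    rw [hp, inv_mul_cancel_left₀ hlam0.ne', inv_mul_cancel_left₀ (hlampos j).ne']
  have hbessel : ∑ j, lam j * ⟪ubar j, u - p⟫ ^ 2 ≤ ‖u - p‖ ^ 2 := by
    have hon : Orthonormal ℝ (fun j => Real.sqrt (lam j) • ubar j) := by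
      rw [orthonormal_iff_ite]
      intro j k
      have h := (heig j (ubar k) (hmem k)).symm.trans (horth j k)
      rw [real_inner_smul_left, real_inner_smul_right]
      by_cases hjk : j = k
      · subst hjk
        rw [← mul_assoc, Real.mul_self_sqrt (hlampos j).le, h]
      · rw [if_neg hjk] at h ⊢
        rw [(mul_eq_zero.mp h).resolve_left (hlampos j).ne', mul_zero, mul_zero]
    have h := hon.sum_inner_products_le (u - p) (s := Finset.univ)
    simpa only [real_inner_smul_left, Real.norm_eq_abs, sq_abs, mul_pow,
      Real.sq_sqrt (hlampos _).le] using h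
  have hgap : ∀ j, j ≠ i → δl ^ 2 * a p (ubar j) ^ 2 ≤ ⟪ubar j, u - p⟫ ^ 2 := by
    intro j hj
    have h : δl ≤ |(lam j)⁻¹ - lam0⁻¹| := by
      rw [hδl]
      refine csInf_le ⟨0, ?_⟩ ⟨j, hj, rfl⟩
      rintro r ⟨k, -, rfl⟩
      exact abs_nonneg _
    rw [hinner, mul_pow, ← sq_abs (lam0⁻¹ - (lam j)⁻¹), abs_sub_comm]
    gcongr
  have hpnorm : a p p = ∑ j, a p (ubar j) ^ 2 := by
    have : Nonempty (Fin N) := ⟨i⟩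
    have hp := eq_sum_smul_of_bilinForm_orthonormal a H (by simp [hdim]) ubar hmem horth hpH
    nth_rewrite 2 [hp]
    simp [map_sum, sq]
  have hpart : δl ^ 2 * a (p - E p) (p - E p) ≤ (lam ⟨0, i.pos⟩)⁻¹ * ‖u - p‖ ^ 2 := by
    have hl := hlampos ⟨0, i.pos⟩
    rw [hEnorm, hpnorm, ← Finset.sum_erase_eq_sub (Finset.mem_univ i), Finset.mul_sum]
    calc ∑ j ∈ Finset.univ.erase i, δl ^ 2 * a p (ubar j) ^ 2
        ≤ ∑ j ∈ Finset.univ.erase i, ⟪ubar j, u - p⟫ ^ 2 :=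
          Finset.sum_le_sum fun j hj => hgap j (Finset.ne_of_mem_erase hj)
      _ ≤ ∑ j, ⟪ubar j, u - p⟫ ^ 2 :=
          Finset.sum_le_sum_of_subset_of_nonneg (Finset.erase_subset _ _)
            fun _ _ _ => sq_nonneg _
      _ ≤ ∑ j, (lam ⟨0, i.pos⟩)⁻¹ * (lam j * ⟪ubar j, u - p⟫ ^ 2) := by
          refine Finset.sum_le_sum fun j _ => ?_
          rw [le_inv_mul_iff₀ hl]
          exact mul_le_mul_of_nonneg_right (hmono (Nat.zero_le j)) (sq_nonneg _)
      _ ≤ (lam ⟨0, i.pos⟩)⁻¹ * ‖u - p‖ ^ 2 := by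
          rw [← Finset.mul_sum]
          exact mul_le_mul_of_nonneg_left hbessel (inv_nonneg.mpr hl.le)
  have hdiscrete : Real.sqrt (a (p - E p) (p - E p)) ≤
      Real.sqrt ((lam ⟨0, i.pos⟩)⁻¹) / δl * ‖u - p‖ := by
    refine Real.sqrt_le_iff.mpr ⟨by positivity, ?_⟩
    rw [mul_pow, div_pow, Real.sq_sqrt (inv_nonneg.mpr (hlampos _).le), div_mul_eq_mul_div,
      le_div_iff₀ (by positivity), mul_comm]
    exact hpart
  have hsplit : u - E u = (u - p - E (u - p)) + (p - E p) := by
    simp only [hE, map_sub, LinearMap.sub_apply, sub_smul]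
    abel
  rw [hsplit]
  linarith [sqrt_bilinForm_add_le a hsymm hnonneg (u - p - E (u - p)) (p - E p),
    Real.sqrt_nonneg (a (u - p) (u - p))]
end

section
/- Assume δ_λ > 0. Then ‖p − E_i p‖_b ≤ (μ̄_1 / δ_λ) ‖u − p‖_b. (Key intermediate b-norm estimate in the proof of Theorem 2.6.) -/
open RealInnerProductSpace

/-- If every coefficient of `q ∈ H` in an orthonormal basis of `H` is at most `C` times the
corresponding coefficient of `w`, then `‖q‖ ≤ C * ‖w‖`. -/
theorem norm_le_mul_norm_of_abs_inner_le {W ι : Type*} [NormedAddCommGroup W]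
    [InnerProductSpace ℝ W] [Fintype ι] [Nonempty ι] {H : Submodule ℝ W} {e : ι → W}
    (he : Orthonormal ℝ e) (heH : ∀ j, e j ∈ H) (hcard : Fintype.card ι = Module.finrank ℝ H)
    {C : ℝ} (hC : 0 ≤ C) {q w : W} (hq : q ∈ H)
    (h : ∀ j, |⟪e j, q⟫| ≤ C * |⟪e j, w⟫|) : ‖q‖ ≤ C * ‖w‖ := by
  have he' : Orthonormal ℝ (fun j ↦ (⟨e j, heH j⟩ : H)) :=
    ⟨fun j ↦ he.1 j, fun j k hjk ↦ he.2 hjk⟩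
  have hspan : ⊤ ≤ Submodule.span ℝ (Set.range fun j ↦ (⟨e j, heH j⟩ : H)) :=
    (he'.linearIndependent.span_eq_top_of_card_eq_finrank hcard).ge
  have hparseval : ∑ j, ⟪e j, q⟫ ^ 2 = ‖q‖ ^ 2 := by
    simpa using (OrthonormalBasis.mk he' hspan).sum_sq_norm_inner_right ⟨q, hq⟩
  have hbessel : ∑ j, ⟪e j, w⟫ ^ 2 ≤ ‖w‖ ^ 2 := by
    simpa using he.sum_inner_products_le w (s := Finset.univ)
  refine (sq_le_sq₀ (norm_nonneg q) (by positivity)).1 ?_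
  calc ‖q‖ ^ 2 = ∑ j, ⟪e j, q⟫ ^ 2 := hparseval.symm
    _ ≤ ∑ j, C ^ 2 * ⟪e j, w⟫ ^ 2 := Finset.sum_le_sum fun j _ ↦ by
      have := pow_le_pow_left₀ (abs_nonneg _) (h j) 2
      rwa [mul_pow, sq_abs, sq_abs] at this
    _ = C ^ 2 * ∑ j, ⟪e j, w⟫ ^ 2 := Finset.mul_sum .. |>.symm
    _ ≤ (C * ‖w‖) ^ 2 := by rw [mul_pow]; gcongr

/-- key intermediate `b`-norm estimate in the proof of Theorem 2.6.
`‖p − E_i p‖_b ≤ (μ̄_1/δ_λ) ‖u − p‖_b`. -/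
theorem single_projection_b_estimate
    {W : Type*} [NormedAddCommGroup W] [InnerProductSpace ℝ W]
    (a : LinearMap.BilinForm ℝ W)
    (hsymm : ∀ x y : W, a x y = a y x)
    (hposdef : ∀ x : W, x ≠ 0 → 0 < a x x)
    (H : Submodule ℝ W) (N : ℕ) (hdim : Module.finrank ℝ H = N)
    (ubar : Fin N → W) (hmem : ∀ j, ubar j ∈ H)
    (lam : Fin N → ℝ) (hlampos : ∀ j, 0 < lam j) (hmono : Monotone lam)
    (horth : ∀ i j, a (ubar i) (ubar j) = if i = j then 1 else 0)
    (heig : ∀ j, ∀ v ∈ H, a (ubar j) v = lam j * ⟪ubar j, v⟫)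
    (lam0 : ℝ) (hlam0 : 0 < lam0) (u : W)
    (p : W) (hpH : p ∈ H)
    (hproj : ∀ v ∈ H, a p v = lam0 * ⟪u, v⟫)
    (i : Fin N) (E : W → W)
    (hE : ∀ w, E w = a w (ubar i) • ubar i)
    (δl : ℝ)
    (hδl : δl = sInf {r : ℝ | ∃ j : Fin N, j ≠ i ∧ r = |(lam j)⁻¹ - lam0⁻¹|})
    (hδlpos : 0 < δl) :
    ‖p - E p‖ ≤ (lam ⟨0, i.pos⟩)⁻¹ / δl * ‖u - p‖ := by
  have : Nonempty (Fin N) := ⟨i⟩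
  have hinner (j : Fin N) {v : W} (hv : v ∈ H) : ⟪ubar j, v⟫ = (lam j)⁻¹ * a (ubar j) v := by
    rw [heig j v hv, inv_mul_cancel_left₀ (hlampos j).ne']
  have hinner_u (j : Fin N) : ⟪ubar j, u⟫ = lam0⁻¹ * a (ubar j) p := by
    rw [hsymm, hproj _ (hmem j), inv_mul_cancel_left₀ hlam0.ne', real_inner_comm]
  have he : Orthonormal ℝ (fun j ↦ √(lam j) • ubar j) := by
    rw [orthonormal_iff_ite]
    intro j k
    rw [real_inner_smul_left, real_inner_smul_right, hinner j (hmem k), horth]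
    split_ifs with hjk
    · subst hjk
      rw [mul_one, ← mul_assoc, Real.mul_self_sqrt (hlampos j).le,
        mul_inv_cancel₀ (hlampos j).ne']
    · simp
  have hEp : E p ∈ H := by
    rw [hE]
    exact H.smul_mem _ (hmem i)
  refine norm_le_mul_norm_of_abs_inner_le he (fun j ↦ H.smul_mem _ (hmem j)) (by simp [hdim])
    (div_nonneg (inv_nonneg.2 (hlampos _).le) hδlpos.le) (H.sub_mem hpH hEp) fun j ↦ ?_
  have hμ : (lam j)⁻¹ ≤ (lam ⟨0, i.pos⟩)⁻¹ :=
    inv_anti₀ (hlampos _) (hmono (Fin.mk_le_of_le_val (Nat.zero_le _)))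
  have hμ_pos : 0 < (lam j)⁻¹ := inv_pos.2 (hlampos j)
  rw [real_inner_smul_left, real_inner_smul_left, abs_mul, abs_mul, mul_left_comm]
  refine mul_le_mul_of_nonneg_left ?_ (abs_nonneg _)
  rw [hinner j (H.sub_mem hpH hEp), inner_sub_right, hinner_u, hinner j hpH, hE, map_sub,
    map_smul, horth, smul_eq_mul]
  split_ifs with hji
  · subst hji
    rw [mul_one, hsymm p, sub_self, mul_zero, abs_zero]
    exact mul_nonneg (div_nonneg (hμ_pos.le.trans hμ) hδlpos.le) (abs_nonneg _)
  · have hgap : δl ≤ |lam0⁻¹ - (lam j)⁻¹| := by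
      rw [hδl, abs_sub_comm]
      refine csInf_le ⟨0, ?_⟩ ⟨j, hji, rfl⟩
      rintro _ ⟨k, -, rfl⟩
      exact abs_nonneg _
    rw [mul_zero, sub_zero, ← sub_mul, abs_mul, abs_mul, abs_of_pos hμ_pos, ← mul_assoc]
    refine mul_le_mul_of_nonneg_right ?_ (abs_nonneg _)
    rw [div_mul_eq_mul_div, le_div_iff₀ hδlpos]
    exact mul_le_mul hμ hgap hδlpos.le (hμ_pos.le.trans hμ)
end

section
/- For every subspace S ⊆ H and every w ∈ H, the a-orthogonal projection error satisfies the duality estimate ‖w − P_S w‖_b ≤ η_a(S) · ‖w − P_S w‖_a. (Abstract form of the Aubin–Nitsche type estimate (3.5) used in the analysis of the augmented subspace method.) -/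
open RealInnerProductSpace

/-- A positive definite bilinear form on a finite-dimensional normed space is coercive. -/
theorem exists_pos_mul_sq_norm_le_apply_self {E : Type*} [NormedAddCommGroup E] [NormedSpace ℝ E]
    [FiniteDimensional ℝ E] (B : LinearMap.BilinForm ℝ E) (hB : ∀ v, v ≠ 0 → 0 < B v v) :
    ∃ c : ℝ, 0 < c ∧ ∀ v, c * ‖v‖ ^ 2 ≤ B v v := by
  have := FiniteDimensional.proper_real E
  have hcont : Continuous fun v => B v v := by
    have h : Continuous fun v => B.toContinuousBilinearMap v v := by fun_prop
    simpa using h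
  rcases subsingleton_or_nontrivial E with hE | hE
  · exact ⟨1, one_pos, fun v => by simp [Subsingleton.elim v 0]⟩
  obtain ⟨u, hu, hmin⟩ := (isCompact_sphere (0 : E) 1).exists_isMinOn
    (NormedSpace.sphere_nonempty.2 zero_le_one) hcont.continuousOn
  refine ⟨B u u, hB u (ne_zero_of_mem_unit_sphere ⟨u, hu⟩), fun v => ?_⟩
  rcases eq_or_ne v 0 with rfl | hv
  · simp
  have hv' : 0 < ‖v‖ := norm_pos_iff.2 hv
  have hmem : ‖v‖⁻¹ • v ∈ Metric.sphere (0 : E) 1 := by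
    simp [norm_smul, hv'.ne']
  have h : B u u ≤ B (‖v‖⁻¹ • v) (‖v‖⁻¹ • v) := isMinOn_iff.1 hmin _ hmem
  simp only [map_smul, LinearMap.smul_apply, smul_eq_mul] at h
  calc B u u * ‖v‖ ^ 2 ≤ ‖v‖⁻¹ * (‖v‖⁻¹ * B v v) * ‖v‖ ^ 2 := by gcongr
    _ = B v v := by field_simp

/-- Cauchy–Schwarz for a symmetric bilinear form that is nonnegative on a subspace. -/
theorem apply_le_sqrt_mul_sqrt_of_mem {W : Type*} [AddCommGroup W] [Module ℝ W]
    (H : Submodule ℝ W) (a : LinearMap.BilinForm ℝ W) (hsymm : ∀ x y : W, a x y = a y x)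
    (hnonneg : ∀ v ∈ H, 0 ≤ a v v) {x y : W} (hx : x ∈ H) (hy : y ∈ H) :
    a x y ≤ Real.sqrt (a x x) * Real.sqrt (a y y) := by
  have h : a x y * a y x ≤ a x x * a y y :=
    LinearMap.BilinForm.apply_mul_apply_le_of_forall_zero_le (a.restrict H)
      (fun v => hnonneg v v.2) ⟨x, hx⟩ ⟨y, hy⟩
  rw [← Real.sqrt_mul (hnonneg x hx)]
  exact Real.le_sqrt_of_sq_le (by rwa [hsymm y x, ← sq] at h)

/-- abstract Aubin–Nitsche type duality estimate (3.5).
For every subspace `S ⊆ H` and every `w ∈ H`, the `a`-orthogonal projection error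
satisfies `‖w − P_S w‖_b ≤ η_a(S) ‖w − P_S w‖_a`, where
`η_a(S) = sup_{‖f‖_b = 1} inf_{v ∈ S} ‖T f − v‖_a` and `T` is the solution operator
determined by `a(Tf, v) = b(f, v)` for all `v ∈ H`. -/
theorem duality_estimate
    {W : Type*} [NormedAddCommGroup W] [InnerProductSpace ℝ W]
    (H S : Submodule ℝ W) (hSH : S ≤ H) [FiniteDimensional ℝ H]
    (a : LinearMap.BilinForm ℝ W)
    (hsymm : ∀ x y : W, a x y = a y x)
    (hpos : ∀ v ∈ H, v ≠ 0 → 0 < a v v)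
    (T : W → W) (hTmem : ∀ f : W, T f ∈ H)
    (hT : ∀ f : W, ∀ v ∈ H, a (T f) v = ⟪f, v⟫)
    (P : W → W) (hPmem : ∀ w ∈ H, P w ∈ S)
    (hPorth : ∀ w ∈ H, ∀ s ∈ S, a (w - P w) s = 0)
    (η : ℝ)
    (hη : η = sSup {r : ℝ | ∃ f : W, ‖f‖ = 1 ∧
      r = sInf {s : ℝ | ∃ v ∈ S, s = Real.sqrt (a (T f - v) (T f - v))}}) :
    ∀ w ∈ H, ‖w - P w‖ ≤ η * Real.sqrt (a (w - P w) (w - P w)) := by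
  intro w hw
  have hnonneg : ∀ v ∈ H, 0 ≤ a v v := fun v hv => by
    rcases eq_or_ne v 0 with rfl | hv0
    · simp
    · exact (hpos v hv hv0).le
  have heH : w - P w ∈ H := H.sub_mem hw (hSH (hPmem w hw))
  have horth := hPorth w hw
  generalize w - P w = e at heH horth ⊢
  rcases eq_or_ne e 0 with rfl | he
  · simp
  have he' : 0 < ‖e‖ := norm_pos_iff.2 he
  have hae : 0 < Real.sqrt (a e e) := Real.sqrt_pos.2 (hpos e heH he)
  obtain ⟨c, hc, hcoer⟩ := exists_pos_mul_sq_norm_le_apply_self (a.restrict H)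
    fun v hv => hpos v v.2 (by simpa using hv)
  have hbdd : BddAbove {r : ℝ | ∃ f : W, ‖f‖ = 1 ∧
      r = sInf {s : ℝ | ∃ v ∈ S, s = Real.sqrt (a (T f - v) (T f - v))}} := by
    refine ⟨Real.sqrt (1 / c), ?_⟩
    rintro _ ⟨f, hf, rfl⟩
    have hlow : BddBelow {s : ℝ | ∃ v ∈ S, s = Real.sqrt (a (T f - v) (T f - v))} :=
      ⟨0, by rintro _ ⟨v, -, rfl⟩; exact Real.sqrt_nonneg _⟩
    refine (csInf_le hlow ⟨0, S.zero_mem, rfl⟩).trans (Real.sqrt_le_sqrt ?_)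
    rw [sub_zero]
    have h₁ : c * ‖T f‖ ^ 2 ≤ a (T f) (T f) := hcoer ⟨T f, hTmem f⟩
    have h₂ : a (T f) (T f) ≤ ‖T f‖ := by
      simpa [hT f _ (hTmem f), hf] using real_inner_le_norm f (T f)
    rw [le_div_iff₀ hc]
    rcases (norm_nonneg (T f)).eq_or_lt with h0 | h0
    · nlinarith
    · have h₃ : c * ‖T f‖ ≤ 1 := le_of_mul_le_mul_right (by linarith) h0
      nlinarith
  rw [← div_le_iff₀ hae, hη]
  refine le_trans ?_ (le_csSup hbdd ⟨‖e‖⁻¹ • e, by simp [norm_smul, he'.ne'], rfl⟩)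
  refine le_csInf ⟨_, 0, S.zero_mem, rfl⟩ ?_
  rintro _ ⟨v, hv, rfl⟩
  rw [div_le_iff₀ hae]
  calc ‖e‖ = a (T (‖e‖⁻¹ • e) - v) e := by
        rw [map_sub, LinearMap.sub_apply, hsymm v e, horth v hv, hT _ e heH,
          real_inner_smul_left, real_inner_self_eq_norm_sq]
        field_simp
        simp
    _ ≤ _ := apply_le_sqrt_mul_sqrt_of_mem H a hsymm hnonneg
        (H.sub_mem (hTmem _) (hSH hv)) heH
end

section
/- Let λ̄ > 0 and ū ∈ H satisfy the eigenvalue relation a(ū, v) = λ̄ b(ū, v) for all v ∈ H. Let S ⊆ H be a subspace and q ∈ H be such that λ̄ · T q ∈ S. Then ‖ū − P_S ū‖_a² ≤ λ̄ ‖ū − q‖_b · ‖ū − P_S ū‖_b. (Abstract form of the key identity-based estimate (3.20) in the proofs of Theorems 3.1 and 3.2: the augmented subspace built from the solved correction λ̄ T q captures the eigenvector up to the b-norm error of q.) -/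
open RealInnerProductSpace

/-- abstract form of the key identity-based estimate (3.20).
If `a(ū, v) = λ̄ b(ū, v)` for all `v ∈ H` and the augmented subspace `S` contains
the solved correction `λ̄ T q`, then
`‖ū − P_S ū‖_a² ≤ λ̄ ‖ū − q‖_b ‖ū − P_S ū‖_b`. -/
theorem augmented_subspace_identity_estimate
    {W : Type*} [NormedAddCommGroup W] [InnerProductSpace ℝ W]
    (H S : Submodule ℝ W) (hSH : S ≤ H) [FiniteDimensional ℝ H]
    (a : LinearMap.BilinForm ℝ W)
    (hsymm : ∀ x y : W, a x y = a y x)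
    (hpos : ∀ v ∈ H, v ≠ 0 → 0 < a v v)
    (T : W → W) (hTmem : ∀ f : W, T f ∈ H)
    (hT : ∀ f : W, ∀ v ∈ H, a (T f) v = ⟪f, v⟫)
    (P : W → W) (hPmem : ∀ w ∈ H, P w ∈ S)
    (hPorth : ∀ w ∈ H, ∀ s ∈ S, a (w - P w) s = 0)
    (lambar : ℝ) (hlambar : 0 < lambar)
    (ubar : W) (hubar : ubar ∈ H)
    (heig : ∀ v ∈ H, a ubar v = lambar * ⟪ubar, v⟫)
    (q : W) (hq : q ∈ H) (hTq : lambar • T q ∈ S) :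
    a (ubar - P ubar) (ubar - P ubar) ≤
      lambar * (‖ubar - q‖ * ‖ubar - P ubar‖) := by
  have he : ubar - P ubar ∈ H := H.sub_mem hubar (hSH (hPmem ubar hubar))
  have hP := hPorth ubar hubar _ (hPmem ubar hubar)
  have hTq' : lambar * a (T q) (ubar - P ubar) = 0 := by
    rw [hsymm, ← smul_eq_mul, ← map_smul]
    exact hPorth ubar hubar _ hTq
  calc a (ubar - P ubar) (ubar - P ubar)
      = a ubar (ubar - P ubar) - a (ubar - P ubar) (P ubar) := by
        rw [map_sub (a (ubar - P ubar)), hsymm _ ubar]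
    _ = lambar * ⟪ubar - q, ubar - P ubar⟫ := by
        rw [hT q _ he] at hTq'
        rw [hP, heig _ he, inner_sub_left]
        linarith
    _ ≤ lambar * (‖ubar - q‖ * ‖ubar - P ubar‖) := by
        gcongr
        exact real_inner_le_norm _ _
end
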